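/- arXiv:2104.04341 — 2 statements merged into one kernel-verified Lean document; each statement's English description precedes it below -/
import Mathlib

section
/- Let 𝒜 = (a_i)_{i≥1} be a sequence of positive integers, and let k ≥ 1 and m ≥ 2 be integers. Then there exist at most a_1 + ⋯ + a_k − 1 consecutive values of n with p_𝒜(n,k) ≡ 0 (mod m); that is, for every i ∈ ℕ there exists n with i ≤ n ≤ i + (a_1 + ⋯ + a_k) − 1 such that p_𝒜(n,k) ≢ 0 (mod m). -/
/-- `pA a k n` is the number of multi-color partitions of `n` into parts
`a 1, …, a k`. -/
noncomputable def pA (a : ℕ → ℕ) (k : ℕ) (n : ℤ) : ℕ :=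
  Nat.card {x : Fin k → ℕ // ∑ i : Fin k, (x i : ℤ) * (a (i.val + 1) : ℤ) = n}

/-- The solution sets counted by `pA` are finite. -/
theorem finite_pA_solutions (a : ℕ → ℕ) (ha : ∀ i, 0 < a i) (k : ℕ) (n : ℤ) :
    Finite {x : Fin k → ℕ // ∑ i : Fin k, (x i : ℤ) * (a (i.val + 1) : ℤ) = n} := by
  refine Set.Finite.to_subtype
    ((Set.Finite.pi' fun _ : Fin k => Set.finite_Iic n.toNat).subset fun x hx i => ?_)
  have hx' : ∑ i : Fin k, (x i : ℤ) * (a (i.val + 1) : ℤ) = n := hx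
  have hle : (x i : ℤ) * (a (i.val + 1) : ℤ) ≤ n := hx' ▸
    Finset.single_le_sum (f := fun i : Fin k => (x i : ℤ) * (a (i.val + 1) : ℤ))
      (fun j _ => by positivity) (Finset.mem_univ i)
  have hpos : (1 : ℤ) ≤ a (i.val + 1) := by exact_mod_cast ha _
  have : (x i : ℤ) ≤ n := by nlinarith
  simp only [Set.mem_Iic]
  omega

/-- Splitting the partitions of `n` by whether the last part is used. -/
theorem pA_succ (a : ℕ → ℕ) (ha : ∀ i, 0 < a i) (k : ℕ) (n : ℤ) :
    pA a (k + 1) n = pA a k n + pA a (k + 1) (n - a (k + 1)) := by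
  have := finite_pA_solutions a ha k n
  have := finite_pA_solutions a ha (k + 1) (n - a (k + 1))
  unfold pA
  rw [← Nat.card_sum]
  symm
  refine Nat.card_eq_of_bijective
    (Sum.elim (fun y => ⟨Fin.snoc (α := fun _ => ℕ) y.1 0, ?_⟩)
      (fun y => ⟨y.1 + Pi.single (Fin.last k) 1, ?_⟩)) ⟨?_, ?_⟩
  · simpa [Fin.sum_univ_castSucc] using y.2
  · have hy := y.2
    simp only [Fin.sum_univ_castSucc] at hy ⊢
    simp [(Fin.castSucc_lt_last _).ne] at hy ⊢
    linarith
  · rintro (⟨y, hy⟩ | ⟨y, hy⟩) (⟨z, hz⟩ | ⟨z, hz⟩) h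
    · simpa using h
    · simpa using congrFun (congrArg Subtype.val h) (Fin.last k)
    · simpa using congrFun (congrArg Subtype.val h) (Fin.last k)
    · simpa using h
  · rintro ⟨x, hx⟩
    rcases hl : x (Fin.last k) with _ | c
    · refine ⟨Sum.inl ⟨Fin.init x, ?_⟩, ?_⟩
      · simpa [Fin.sum_univ_castSucc, hl, Fin.init] using hx
      · simp [← hl]
    · refine ⟨Sum.inr ⟨Function.update x (Fin.last k) c, ?_⟩, ?_⟩
      · simp only [Fin.sum_univ_castSucc] at hx ⊢
        simp [hl, (Fin.castSucc_lt_last _).ne] at hx ⊢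
        linarith
      · ext j
        rcases eq_or_ne j (Fin.last k) with rfl | hj
        · simp [hl]
        · simp [hj]

/-- A nonnegative multiple of the only part has exactly one partition. -/
theorem pA_one_mul (a : ℕ → ℕ) (ha : ∀ i, 0 < a i) (q : ℕ) :
    pA a 1 ((q : ℤ) * a 1) = 1 := by
  have h1 : a 1 ≠ 0 := (ha 1).ne'
  refine Nat.card_eq_one_iff_unique.mpr ⟨⟨?_⟩, ⟨⟨fun _ => q, by simp⟩⟩⟩
  rintro ⟨x, hx⟩ ⟨y, hy⟩
  simp [h1] at hx hy
  ext j
  fin_cases j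
  simp [hx, hy]

/-- Windows of length `a 1 + ⋯ + a k` that meet the nonnegative integers contain a value not
divisible by `m`. -/
theorem exists_not_dvd_pA (a : ℕ → ℕ) (ha : ∀ i, 0 < a i) (k m : ℕ) (hk : 1 ≤ k) (hm : 2 ≤ m) :
    ∀ i : ℤ, 0 < i + ((∑ j ∈ Finset.Icc 1 k, a j : ℕ) : ℤ) →
      ∃ n : ℤ, i ≤ n ∧ n < i + ((∑ j ∈ Finset.Icc 1 k, a j : ℕ) : ℤ) ∧ ¬ m ∣ pA a k n := by
  induction k, hk using Nat.le_induction with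
  | base =>
    intro i hi
    simp only [Finset.Icc_self, Finset.sum_singleton] at hi ⊢
    have h1 : (0 : ℤ) < a 1 := by exact_mod_cast ha 1
    have hdiv := Int.emod_add_mul_ediv (-i) (a 1)
    have hnonneg := Int.emod_nonneg (-i) h1.ne'
    have hlt := Int.emod_lt_of_pos (-i) h1
    have hq : 0 ≤ -(-i / (a 1 : ℤ)) := by
      by_contra! hneg
      nlinarith
    obtain ⟨q, hq⟩ := Int.eq_ofNat_of_zero_le hq
    have hqi : (q : ℤ) * a 1 = i + -i % (a 1 : ℤ) := by
      rw [← hq]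
      linarith
    refine ⟨q * a 1, by omega, by omega, ?_⟩
    rw [pA_one_mul a ha, Nat.dvd_one]
    omega
  | succ k hk ih =>
    intro i hi
    rw [Finset.sum_Icc_succ_top (by omega)] at hi ⊢
    simp only [Nat.cast_add] at hi ⊢
    obtain ⟨n, hin, hni, hn⟩ := ih (i + a (k + 1)) (by linarith)
    by_contra! h
    refine hn ((Nat.dvd_add_left (h (n - a (k + 1)) (by linarith) (by linarith))).mp ?_)
    rw [← pA_succ a ha]
    exact h n (by linarith [Int.natCast_nonneg (a (k + 1))]) (by linarith)

/-- There are at most `a 1 + ⋯ + a k - 1` consecutive values of `n` with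
`p_𝒜(n,k) ≡ 0 (mod m)`. -/
theorem stmt_4 (a : ℕ → ℕ) (ha : ∀ i, 0 < a i) (k m : ℕ) (hk : 1 ≤ k) (hm : 2 ≤ m) :
    ∀ i : ℕ, ∃ n : ℕ, i ≤ n ∧ n ≤ i + (∑ j ∈ Finset.Icc 1 k, a j) - 1 ∧
      ¬ (m ∣ pA a k (n : ℤ)) := by
  intro i
  have hpos : 0 < ∑ j ∈ Finset.Icc 1 k, a j :=
    Finset.sum_pos (fun j _ => ha j) ⟨1, by simp [hk]⟩
  obtain ⟨n, hin, hni, hn⟩ := exists_not_dvd_pA a ha k m hk hm i (by omega)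
  lift n to ℕ using by omega
  exact ⟨n, by omega, by omega, hn⟩
end

section
/- Let m be a prime number, let i ∈ {1,2,…,m−1} and let k ≥ 2 be an integer. Then the natural density of {n ∈ ℕ : p_ℳ(n,k) ≡ i (mod m)} equals (m−1)^{k−2}/m^{k−1}; i.e. lim_{N→∞} #{n ≤ N : p_ℳ(n,k) ≡ i (mod m)}/N = (m−1)^{k−2}/m^{k−1}. -/
open Filter

/-- `pM m k n` is the number of restricted `m`-ary partitions of `n` with parts
`1, m, m^2, …, m^(k-1)`. -/
noncomputable def pM (m k n : ℕ) : ℕ :=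
  Nat.card {x : Fin k → ℕ // ∑ i : Fin k, x i * m ^ (i : ℕ) = n}

/-- Splitting off the number of parts equal to `1`. -/
def partitionEquiv (m : ℕ) (hm : 0 < m) (k n : ℕ) :
    {x : Fin (k + 1) → ℕ // ∑ i : Fin (k + 1), x i * m ^ (i : ℕ) = n} ≃
      Σ j : Fin (n / m + 1), {y : Fin k → ℕ // ∑ i : Fin k, y i * m ^ (i : ℕ) = j} where
  toFun x := ⟨⟨∑ i : Fin k, x.1 i.succ * m ^ (i : ℕ), by
      rw [Nat.lt_succ_iff, Nat.le_div_iff_mul_le hm, Finset.sum_mul]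
      have h := x.2
      rw [Fin.sum_univ_succ] at h
      simp only [Fin.val_succ, pow_succ, ← mul_assoc] at h
      omega⟩, fun i => x.1 i.succ, rfl⟩
  invFun y := ⟨Fin.cons (n - y.1 * m) y.2.1, by
      rw [Fin.sum_univ_succ]
      simp only [Fin.cons_zero, Fin.cons_succ, Fin.val_succ, pow_succ, ← mul_assoc,
        ← Finset.sum_mul, y.2.2]
      have h := y.1.2
      rw [Nat.lt_succ_iff, Nat.le_div_iff_mul_le hm] at h
      simp only [Fin.val_zero, pow_zero, mul_one]
      omega⟩
  left_inv x := by
    obtain ⟨x, rfl⟩ := x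
    ext i
    refine Fin.cases ?_ (fun i => ?_) i
    · simp only [Fin.cons_zero]
      rw [Fin.sum_univ_succ, Finset.sum_mul]
      simp [pow_succ, ← mul_assoc]
    · simp
  right_inv y := by
    obtain ⟨⟨j, hj⟩, y, hy⟩ := y
    dsimp only at hy
    subst hy
    rfl

theorem finite_partition (m : ℕ) (hm : 0 < m) (k : ℕ) : ∀ n : ℕ,
    Finite {x : Fin k → ℕ // ∑ i : Fin k, x i * m ^ (i : ℕ) = n} := by
  induction k with
  | zero => intro n; infer_instance
  | succ k ih => exact fun n => Finite.of_equiv _ (partitionEquiv m hm k n).symm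

theorem pM_succ (m : ℕ) (hm : 0 < m) (k n : ℕ) :
    pM m (k + 1) n = ∑ j ∈ Finset.range (n / m + 1), pM m k j := by
  have := finite_partition m hm k
  rw [pM, Nat.card_congr (partitionEquiv m hm k n), Nat.card_sigma, Finset.sum_range]
  rfl

theorem pM_one (m : ℕ) (hm : 0 < m) (n : ℕ) : pM m 1 n = 1 := by
  rw [pM_succ m hm, Finset.sum_range_succ', Finset.sum_eq_zero]
  · simp [pM]
  · intro j _
    simp [pM]

theorem sum_range_div_zmod (m : ℕ) (g : ℕ → ZMod m) (N : ℕ) :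
    ∑ j ∈ Finset.range (N + 1), g (j / m) = (N + 1) * g (N / m) := by
  induction N with
  | zero => simp
  | succ N ih =>
    rw [Finset.sum_range_succ, ih, Nat.succ_div]
    split_ifs with h
    · have h0 : ((N : ZMod m) + 1) = 0 := by
        exact_mod_cast (ZMod.natCast_eq_zero_iff (N + 1) m).2 h
      push_cast
      rw [h0]
      ring
    · push_cast
      ring_nf

/-- The product `∏ j < k, (aⱼ + 1)` modulo `m`, where `aⱼ` are the base-`m` digits of `n`. -/
def digitProd (m : ℕ) : ℕ → ℕ → ZMod m
  | 0, _ => 1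
  | k + 1, n => (n + 1) * digitProd m k (n / m)

theorem cast_pM_succ (m : ℕ) (hm : 0 < m) (k : ℕ) : ∀ n : ℕ,
    (pM m (k + 1) n : ZMod m) = digitProd m k (n / m) := by
  induction k with
  | zero => intro n; simp [pM_one m hm, digitProd]
  | succ k ih =>
    intro n
    rw [pM_succ m hm, Nat.cast_sum, Finset.sum_congr rfl fun j _ => ih j,
      sum_range_div_zmod m (digitProd m k), digitProd]

theorem digitProd_add_pow (m : ℕ) (hm : 0 < m) (k : ℕ) : ∀ n : ℕ,
    digitProd m k (n + m ^ k) = digitProd m k n := by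
  induction k with
  | zero => intro n; rfl
  | succ k ih =>
    intro n
    simp only [digitProd]
    rw [pow_succ, Nat.add_mul_div_right _ _ hm, ih]
    simp

theorem sum_range_mul_zmod (m : ℕ) [NeZero m] (f : ZMod m → ℕ → ℕ) (L : ℕ) :
    ∑ n ∈ Finset.range (L * m), f n (n / m) = ∑ q ∈ Finset.range L, ∑ y, f y q := by
  have hm : 0 < m := NeZero.pos m
  induction L with
  | zero => simp
  | succ L ih =>
    rw [Finset.sum_range_succ, ← ih, add_mul, one_mul, Finset.sum_range_add]
    congr 1
    refine Finset.sum_bij' (fun a _ => (a : ZMod m)) (fun y _ => y.val) ?_ ?_ ?_ ?_ ?_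
    · simp
    · intro y _
      simpa using ZMod.val_lt y
    · intro a ha
      exact ZMod.val_cast_of_lt (Finset.mem_range.1 ha)
    · simp
    · intro a ha
      have ha := Finset.mem_range.1 ha
      rw [mul_comm L m, Nat.mul_add_div hm, Nat.div_eq_of_lt ha]
      simp

theorem sum_digitProd_succ (m : ℕ) [NeZero m] (F : ZMod m → ℕ) (k : ℕ) :
    ∑ n ∈ Finset.range (m ^ (k + 1)), F (digitProd m (k + 1) n) =
      ∑ q ∈ Finset.range (m ^ k), ∑ y, F (y * digitProd m k q) := by
  rw [pow_succ]
  refine (sum_range_mul_zmod m (fun y q => F ((y + 1) * digitProd m k q)) _).trans ?_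
  refine Finset.sum_congr rfl fun q _ => ?_
  exact Equiv.sum_comp (Equiv.addRight (1 : ZMod m)) fun y => F (y * digitProd m k q)

theorem sum_digitProd_ne_zero (m : ℕ) [Fact m.Prime] (k : ℕ) :
    ∑ n ∈ Finset.range (m ^ k), (if digitProd m k n ≠ 0 then 1 else 0) = (m - 1) ^ k := by
  induction k with
  | zero => simp [digitProd]
  | succ k ih =>
    rw [sum_digitProd_succ m (fun y => if y ≠ 0 then 1 else 0), pow_succ, ← ih, Finset.sum_mul]
    refine Finset.sum_congr rfl fun q _ => ?_
    by_cases h : digitProd m k q = 0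
    · simp [h]
    · simp only [ne_eq, mul_eq_zero, h, or_false, not_false_eq_true, if_true, one_mul]
      rw [← Finset.card_filter, Finset.filter_ne', Finset.card_erase_of_mem (Finset.mem_univ _),
        Finset.card_univ, ZMod.card]

theorem sum_digitProd_eq (m : ℕ) [Fact m.Prime] (k : ℕ) (i : ZMod m) (hi : i ≠ 0) :
    ∑ n ∈ Finset.range (m ^ (k + 1)), (if digitProd m (k + 1) n = i then 1 else 0) =
      (m - 1) ^ k := by
  rw [sum_digitProd_succ m (fun y => if y = i then 1 else 0), ← sum_digitProd_ne_zero]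
  refine Finset.sum_congr rfl fun q _ => ?_
  by_cases h : digitProd m k q = 0
  · simp [h, hi.symm]
  · simp [h, ← eq_div_iff h]

theorem Nat.count_mul_of_periodic (p : ℕ → Prop) [DecidablePred p] (a : ℕ)
    (hp : ∀ n, p (n + a) ↔ p n) (q : ℕ) : Nat.count p (a * q) = Nat.count p a * q := by
  induction q with
  | zero => simp
  | succ q ih =>
    rw [Nat.mul_succ, add_comm, Nat.count_add, Nat.mul_succ, add_comm]
    simp only [add_comm a, hp, ih]

theorem tendsto_count_of_periodic (p : ℕ → Prop) [DecidablePred p] (a : ℕ) (ha : 0 < a)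
    (hp : ∀ n, p (n + a) ↔ p n) :
    Tendsto (fun N : ℕ => (Nat.count p (N + 1) : ℝ) / N) atTop
      (nhds ((Nat.count p a : ℝ) / a)) := by
  set c := Nat.count p a with hc
  rw [tendsto_iff_norm_sub_tendsto_zero]
  refine squeeze_zero' (Eventually.of_forall fun _ => norm_nonneg _) ?_
    (tendsto_const_div_atTop_nhds_zero_nat ((c : ℝ) + a))
  filter_upwards [eventually_gt_atTop 0] with N hN
  have hlow : c * (N / a) ≤ Nat.count p (N + 1) := by
    rw [hc, ← Nat.count_mul_of_periodic p a hp]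
    exact Nat.count_monotone p ((Nat.mul_div_le N a).trans N.le_succ)
  have hup : Nat.count p (N + 1) ≤ c * (N / a) + a := by
    have hN1 : N + 1 = a * (N / a) + (N % a + 1) := by rw [← add_assoc, Nat.div_add_mod]
    rw [hN1, Nat.count_add, Nat.count_mul_of_periodic p a hp]
    have := Nat.mod_lt N ha
    exact Nat.add_le_add_left ((Nat.count_le _).trans this) _
  have hN' : (0 : ℝ) < N := by exact_mod_cast hN
  have ha' : (0 : ℝ) < a := by exact_mod_cast ha
  have hlow' : (c : ℝ) * (N / a : ℕ) ≤ Nat.count p (N + 1) := by exact_mod_cast hlow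
  have hup' : (Nat.count p (N + 1) : ℝ) ≤ c * (N / a : ℕ) + a := by exact_mod_cast hup
  have h1 : ((N / a : ℕ) : ℝ) ≤ N / a := Nat.cast_div_le
  have h2 : (N : ℝ) / a ≤ (N / a : ℕ) + 1 := by
    rw [div_le_iff₀ ha']
    have := (Nat.lt_mul_div_succ N ha).le
    rw [mul_comm]
    exact_mod_cast this
  have hc0 : (0 : ℝ) ≤ c := Nat.cast_nonneg c
  have h1' := mul_le_mul_of_nonneg_left h1 hc0
  have h2' := mul_le_mul_of_nonneg_left h2 hc0
  have heq : (Nat.count p (N + 1) : ℝ) / N - c / a =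
      (Nat.count p (N + 1) - c * (N / a)) / N := by
    field_simp
  rw [heq, Real.norm_eq_abs, abs_div, abs_of_pos hN']
  gcongr
  rw [abs_le]
  constructor <;> linarith

theorem stmt_8 (m : ℕ) (hm : m.Prime) (i : ℕ) (hi1 : 1 ≤ i) (hi2 : i ≤ m - 1)
    (k : ℕ) (hk : 2 ≤ k) :
    Tendsto (fun N : ℕ =>
        (((Finset.range (N + 1)).filter (fun n : ℕ => pM m k n % m = i)).card : ℝ) / N)
      atTop (nhds (((m : ℝ) - 1) ^ (k - 2) / (m : ℝ) ^ (k - 1))) := by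
  have : Fact m.Prime := ⟨hm⟩
  have hm0 : 0 < m := hm.pos
  obtain ⟨k, rfl⟩ := Nat.exists_eq_add_of_le' hk
  have him : i < m := by omega
  have hi0 : (i : ZMod m) ≠ 0 := by
    rw [Ne, ZMod.natCast_eq_zero_iff]
    exact Nat.not_dvd_of_pos_of_lt hi1 him
  have key : ∀ n, pM m (k + 2) n % m = i ↔ digitProd m (k + 1) (n / m) = i := by
    intro n
    rw [← cast_pM_succ m hm0, ZMod.natCast_eq_natCast_iff', Nat.mod_eq_of_lt him]
  have hper : ∀ n, pM m (k + 2) (n + m ^ (k + 2)) % m = i ↔ pM m (k + 2) n % m = i := by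
    intro n
    rw [key, key, pow_succ, Nat.add_mul_div_right _ _ hm0, digitProd_add_pow m hm0]
  have hcount : Nat.count (fun n => pM m (k + 2) n % m = i) (m ^ (k + 2)) =
      (m - 1) ^ k * m := by
    rw [Nat.count_eq_card_filter_range, Finset.card_filter]
    simp only [key]
    rw [pow_succ]
    refine (sum_range_mul_zmod m
      (fun _ q => if digitProd m (k + 1) q = i then 1 else 0) _).trans ?_
    rw [← sum_digitProd_eq m k i hi0, Finset.sum_mul]
    refine Finset.sum_congr rfl fun q _ => ?_
    simp [ZMod.card, mul_comm]
  have h := tendsto_count_of_periodic (fun n => pM m (k + 2) n % m = i) (m ^ (k + 2))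
    (pow_pos hm0 _) hper
  simp only [hcount, Nat.count_eq_card_filter_range] at h
  convert h using 2
  have hmR : (m : ℝ) ≠ 0 := by exact_mod_cast hm0.ne'
  rw [Nat.add_sub_cancel, show k + 2 - 1 = k + 1 from rfl]
  push_cast [Nat.cast_sub hm.one_le]
  rw [pow_succ (m : ℝ) (k + 1)]
  field_simp
end
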